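/- arXiv:2604.23089 — 3 statements merged into one kernel-verified Lean document; each statement's English description precedes it below -/
import Mathlib

section
/- Let η(X) = ∑_{i=1}^r A_i X A_iᴴ be a completely positive map on M_n(ℂ) which is doubly stochastic, i.e., ∑_i A_i A_iᴴ = I and ∑_i A_iᴴ A_i = I. Then for every positive definite B ∈ M_n(ℂ) with det B = 1, the matrix η(B) is positive definite and det(η(B)) ≥ 1; consequently the capacity Capa(η) = inf{det(η(B)) : B positive definite, det B = 1} equals 1. -/
open Matrix
open scoped ComplexOrder

/-- Applying a doubly stochastic matrix of weights to a positive vector does not decrease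
the product of its entries. -/
theorem prod_le_prod_sum_mul_of_doublyStochastic {ι : Type*} [Fintype ι] {w : ι → ι → ℝ}
    {x : ι → ℝ} (hw : ∀ j k, 0 ≤ w j k) (hrow : ∀ j, ∑ k, w j k = 1)
    (hcol : ∀ k, ∑ j, w j k = 1) (hx : ∀ k, 0 < x k) :
    ∏ k, x k ≤ ∏ j, ∑ k, w j k * x k := by
  calc ∏ k, x k = ∏ k, ∏ j, x k ^ w j k := by
        refine Finset.prod_congr rfl fun k _ => ?_
        rw [← Real.rpow_sum_of_pos (hx k), hcol, Real.rpow_one]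
    _ = ∏ j, ∏ k, x k ^ w j k := Finset.prod_comm
    _ ≤ ∏ j, ∑ k, w j k * x k := by
        refine Finset.prod_le_prod
          (fun j _ => Finset.prod_nonneg fun k _ => Real.rpow_nonneg (hx k).le _) fun j _ => ?_
        exact Real.geom_mean_le_arith_mean_weighted _ _ _ (fun k _ => hw j k) (hrow j)
          fun k _ => (hx k).le

theorem Matrix.mul_diagonal_mul_conjTranspose_apply_self {m n : Type*} [Fintype n]
    [DecidableEq n] (C : Matrix m n ℂ) (d : n → ℝ) (j : m) :
    (C * diagonal (fun k => (d k : ℂ)) * Cᴴ) j j =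
      ((∑ k, Complex.normSq (C j k) * d k : ℝ) : ℂ) := by
  rw [mul_apply]
  push_cast
  refine Finset.sum_congr rfl fun k _ => ?_
  rw [mul_diagonal, conjTranspose_apply, Complex.normSq_eq_conj_mul_self, Complex.star_def]
  ring

/-- A doubly stochastic completely positive map preserves positive definiteness and does not
decrease the determinant of a positive definite matrix. -/
theorem Matrix.PosDef.sum_conj_of_doublyStochastic {n κ : Type*} [Fintype n] [DecidableEq n]
    [Fintype κ] {A : κ → Matrix n n ℂ} (h1 : ∑ i, A i * (A i)ᴴ = 1)
    (h2 : ∑ i, (A i)ᴴ * A i = 1) {B : Matrix n n ℂ} (hB : B.PosDef) :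
    (∑ i, A i * B * (A i)ᴴ).PosDef ∧ B.det.re ≤ (∑ i, A i * B * (A i)ᴴ).det.re := by
  have hM : (∑ i, A i * B * (A i)ᴴ).IsHermitian := by
    simp [IsHermitian, conjTranspose_sum, hB.1.eq, Matrix.mul_assoc]
  set M := ∑ i, A i * B * (A i)ᴴ with hMdef
  let U : Matrix n n ℂ := hM.eigenvectorUnitary
  let V : Matrix n n ℂ := hB.1.eigenvectorUnitary
  have hUU : Uᴴ * U = 1 := Unitary.coe_star_mul_self hM.eigenvectorUnitary
  have hUU' : U * Uᴴ = 1 := Unitary.coe_mul_star_self hM.eigenvectorUnitary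
  have hVV : Vᴴ * V = 1 := Unitary.coe_star_mul_self hB.1.eigenvectorUnitary
  have hVV' : V * Vᴴ = 1 := Unitary.coe_mul_star_self hB.1.eigenvectorUnitary
  have hBdiag : B = V * diagonal (fun k => (hB.1.eigenvalues k : ℂ)) * Vᴴ :=
    hB.1.spectral_theorem
  have hMdiag : Uᴴ * M * U = diagonal (fun k => (hM.eigenvalues k : ℂ)) := by
    have h : M = U * diagonal (fun k => (hM.eigenvalues k : ℂ)) * Uᴴ := hM.spectral_theorem
    calc Uᴴ * M * U
        = (Uᴴ * U) * diagonal (fun k => (hM.eigenvalues k : ℂ)) * (Uᴴ * U) := by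
          conv_lhs => rw [h]
          simp only [Matrix.mul_assoc]
      _ = _ := by rw [hUU, Matrix.one_mul, Matrix.mul_one]
  let C : κ → Matrix n n ℂ := fun i => Uᴴ * A i * V
  let w : n → n → ℝ := fun j k => ∑ i, Complex.normSq (C i j k)
  have hCD (d : n → ℝ) (j : n) :
      (∑ i, C i * diagonal (fun k => (d k : ℂ)) * (C i)ᴴ) j j =
        ((∑ k, w j k * d k : ℝ) : ℂ) := by
    rw [Matrix.sum_apply]
    simp only [Matrix.mul_diagonal_mul_conjTranspose_apply_self, w, Finset.sum_mul]
    rw [Finset.sum_comm, Complex.ofReal_sum]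
  have hC1 : ∑ i, C i * (C i)ᴴ = 1 := by
    calc ∑ i, C i * (C i)ᴴ = ∑ i, Uᴴ * (A i * (V * Vᴴ) * (A i)ᴴ) * U := by
          simp [C, Matrix.mul_assoc]
      _ = Uᴴ * (∑ i, A i * (A i)ᴴ) * U := by
          simp only [hVV', Matrix.mul_one, Finset.mul_sum, Finset.sum_mul]
      _ = 1 := by rw [h1, Matrix.mul_one, hUU]
  have hC2 : ∑ i, (C i)ᴴ * C i = 1 := by
    calc ∑ i, (C i)ᴴ * C i = ∑ i, Vᴴ * ((A i)ᴴ * (U * Uᴴ) * A i) * V := by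
          simp [C, Matrix.mul_assoc]
      _ = Vᴴ * (∑ i, (A i)ᴴ * A i) * V := by
          simp only [hUU', Matrix.mul_one, Finset.mul_sum, Finset.sum_mul]
      _ = 1 := by rw [h2, Matrix.mul_one, hVV]
  have hCB : ∑ i, C i * diagonal (fun k => (hB.1.eigenvalues k : ℂ)) * (C i)ᴴ =
      diagonal (fun k => (hM.eigenvalues k : ℂ)) := by
    calc _ = ∑ i, Uᴴ * (A i * (V * diagonal (fun k => (hB.1.eigenvalues k : ℂ)) * Vᴴ)
            * (A i)ᴴ) * U := by
          simp [C, Matrix.mul_assoc]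
      _ = Uᴴ * M * U := by
          rw [← hBdiag, hMdef, Finset.mul_sum, Finset.sum_mul]
      _ = _ := hMdiag
  have hw (j k : n) : 0 ≤ w j k := Finset.sum_nonneg fun i _ => Complex.normSq_nonneg _
  have hrow (j : n) : ∑ k, w j k = 1 := by
    have h := hCD (fun _ => 1) j
    simp only [Complex.ofReal_one, diagonal_one, hC1, one_apply_eq,
      mul_one] at h
    exact_mod_cast h.symm
  have hcol (k : n) : ∑ j, w j k = 1 := by
    have h := congrFun (congrFun hC2 k) k
    rw [Matrix.sum_apply, one_apply_eq] at h
    simp only [mul_apply, conjTranspose_apply, Complex.star_def,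
      ← Complex.normSq_eq_conj_mul_self] at h
    rw [Finset.sum_comm] at h
    exact_mod_cast h
  have heig (j : n) : hM.eigenvalues j = ∑ k, w j k * hB.1.eigenvalues k := by
    have h := hCD hB.1.eigenvalues j
    rw [hCB, diagonal_apply_eq] at h
    exact_mod_cast h
  have hpos (j : n) : 0 < hM.eigenvalues j := by
    rw [heig]
    refine Finset.sum_pos' (fun k _ => mul_nonneg (hw j k) (hB.eigenvalues_pos k).le) ?_
    obtain ⟨k, hk, hk'⟩ := Finset.exists_ne_zero_of_sum_ne_zero
      (show ∑ k, w j k ≠ 0 by rw [hrow]; exact one_ne_zero)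
    exact ⟨k, hk, mul_pos ((hw j k).lt_of_ne' hk') (hB.eigenvalues_pos k)⟩
  refine ⟨hM.posDef_iff_eigenvalues_pos.mpr hpos, ?_⟩
  have hBdet : B.det = ((∏ k, hB.1.eigenvalues k : ℝ) : ℂ) := by
    simpa using hB.1.det_eq_prod_eigenvalues
  have hMdet : M.det = ((∏ k, hM.eigenvalues k : ℝ) : ℂ) := by
    simpa using hM.det_eq_prod_eigenvalues
  rw [hBdet, hMdet, Complex.ofReal_re, Complex.ofReal_re, Finset.prod_congr rfl fun j _ => heig j]
  exact prod_le_prod_sum_mul_of_doublyStochastic hw hrow hcol hB.eigenvalues_pos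

/-- If `η(X) = ∑ᵢ Aᵢ X Aᵢᴴ` is doubly stochastic, then for every positive
definite `B` with `det B = 1`, `η(B)` is positive definite with `det(η(B)) ≥ 1`; hence the
capacity `inf {det(η(B)) : B ≻ 0, det B = 1}` equals `1`. -/
theorem doubly_stochastic_capacity_one {n r : ℕ}
    (A : Fin r → Matrix (Fin n) (Fin n) ℂ)
    (h1 : ∑ i, A i * (A i)ᴴ = 1) (h2 : ∑ i, (A i)ᴴ * A i = 1) :
    (∀ B : Matrix (Fin n) (Fin n) ℂ, B.PosDef → B.det = 1 →
      (∑ i, A i * B * (A i)ᴴ).PosDef ∧ 1 ≤ (∑ i, A i * B * (A i)ᴴ).det.re) ∧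
    sInf {x : ℝ | ∃ B : Matrix (Fin n) (Fin n) ℂ, B.PosDef ∧ B.det = 1 ∧
      (x : ℂ) = (∑ i, A i * B * (A i)ᴴ).det} = 1 := by
  have key (B : Matrix (Fin n) (Fin n) ℂ) (hB : B.PosDef) (hdet : B.det = 1) :
      (∑ i, A i * B * (A i)ᴴ).PosDef ∧ 1 ≤ (∑ i, A i * B * (A i)ᴴ).det.re := by
    simpa [hdet] using hB.sum_conj_of_doublyStochastic h1 h2
  refine ⟨key, IsLeast.csInf_eq ⟨⟨1, PosDef.one, det_one, ?_⟩, ?_⟩⟩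
  · simp [h1]
  · rintro x ⟨B, hB, hdet, hx⟩
    have h := (key B hB hdet).2
    rwa [← hx, Complex.ofReal_re] at h
end

section
/- Let η(X) = ∑_{i=1}^r A_i X A_i be a completely positive map on M_n(ℂ) with Hermitian Kraus operators A_i, and suppose the set 𝕊 = { W ∈ M_n(ℂ) : W positive definite and η(W) W = I } is nonempty. Then: (a) there exists C ∈ 𝕊 with Tr(C) ≤ Tr(W) for all W ∈ 𝕊; and (b) for any such trace minimizer C, setting Φ(X) = C^{1/2} η(C^{1/2} X C^{1/2}) C^{1/2}, every Hermitian matrix Y with Φ(Y) = −Y satisfies Tr(Y C) = 0. -/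
open Matrix
open scoped ComplexOrder

/-- Real power of a Hermitian (in applications: positive definite) matrix, defined via the
spectral decomposition (functional calculus); junk value `0` for non-Hermitian input. -/
noncomputable def matrixRPow {n : ℕ} (P : Matrix (Fin n) (Fin n) ℂ) (t : ℝ) :
    Matrix (Fin n) (Fin n) ℂ :=
  if hP : P.IsHermitian then
    (hP.eigenvectorUnitary : Matrix (Fin n) (Fin n) ℂ) *
      Matrix.diagonal (fun i => ((hP.eigenvalues i ^ t : ℝ) : ℂ)) *
      (star (hP.eigenvectorUnitary : Matrix (Fin n) (Fin n) ℂ))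
  else 0

/-- The positive square root of a positive definite matrix is Hermitian and squares to it. -/
theorem matrixRPow_half_spec {n : ℕ} {C : Matrix (Fin n) (Fin n) ℂ} (hC : C.PosDef) :
    (matrixRPow C (1 / 2)).IsHermitian ∧ matrixRPow C (1 / 2) * matrixRPow C (1 / 2) = C := by
  have hH := hC.isHermitian
  set U : Matrix (Fin n) (Fin n) ℂ := (hH.eigenvectorUnitary : Matrix (Fin n) (Fin n) ℂ) with hU
  set D : Matrix (Fin n) (Fin n) ℂ :=
    diagonal fun i => ((hH.eigenvalues i ^ (1 / 2 : ℝ) : ℝ) : ℂ) with hD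
  have hdef : matrixRPow C (1 / 2) = U * D * star U := by
    simp only [matrixRPow, dif_pos hH, hU, hD]
  have hUU : star U * U = 1 := Unitary.coe_star_mul_self hH.eigenvectorUnitary
  have hDH : star D = D := by
    rw [hD, star_eq_conjTranspose, diagonal_conjTranspose]
    congr 1
    ext i
    simp
  have hDD : D * D = diagonal (RCLike.ofReal ∘ hH.eigenvalues) := by
    rw [hD, diagonal_mul_diagonal]
    congr 1
    ext i
    have := (hC.eigenvalues_pos i).le
    rw [← Complex.ofReal_mul, ← Real.sqrt_eq_rpow, Real.mul_self_sqrt this]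
    rfl
  refine ⟨?_, ?_⟩
  · rw [hdef, IsHermitian, ← star_eq_conjTranspose]
    simp only [star_mul, star_star, hDH, mul_assoc]
  · conv_rhs => rw [hH.spectral_theorem, Unitary.conjStarAlgAut_apply, ← hDD]
    rw [hdef]
    calc U * D * star U * (U * D * star U) = U * D * (star U * U) * D * star U := by
          simp only [mul_assoc]
      _ = U * (D * D) * star U := by rw [hUU, mul_one]; simp only [mul_assoc]

/-- Hermitian Kraus operators of a unital map anticommute with each Hermitian element of its
`-1`-eigenspace. -/
theorem kraus_mul_eq_neg_mul {ι m : Type*} [Fintype ι] [Fintype m] [DecidableEq m]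
    {B : ι → Matrix m m ℂ} (hB : ∀ i, (B i).IsHermitian) (hB1 : ∑ i, B i * B i = 1)
    {Y : Matrix m m ℂ} (hY : Y.IsHermitian) (hBY : ∑ i, B i * Y * B i = -Y) (i : ι) :
    B i * Y = -Y * B i := by
  set Z : ι → Matrix m m ℂ := fun i => B i * Y + Y * B i with hZ
  have hZH : ∀ i, (Z i)ᴴ = Z i := fun i => by
    simp only [hZ, conjTranspose_add, conjTranspose_mul, (hB i).eq, hY.eq]
    exact add_comm _ _
  have hterm : ∀ i, trace ((Z i)ᴴ * Z i) =
      2 * trace (B i * Y * B i * Y) + 2 * trace (Y * (B i * B i) * Y) := fun i => by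
    have h1 : trace (B i * Y * (Y * B i)) = trace (Y * (B i * B i) * Y) := by
      rw [trace_mul_comm (B i * Y)]
      simp only [mul_assoc]
    have h2 : trace (Y * B i * (Y * B i)) = trace (B i * Y * B i * Y) := by
      rw [mul_assoc, trace_mul_comm Y]
      simp only [mul_assoc]
    rw [hZH]
    simp only [hZ, add_mul, mul_add, trace_add, h1, h2]
    simp only [mul_assoc]
    ring
  have hsum : ∑ i, trace ((Z i)ᴴ * Z i) = 0 := by
    simp only [hterm, Finset.sum_add_distrib, ← Finset.mul_sum, ← trace_sum, ← Finset.sum_mul]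
    rw [hBY, hB1]
    simp
  have hzero := (Finset.sum_eq_zero_iff_of_nonneg
    fun i _ => (posSemidef_conjTranspose_mul_self (Z i)).trace_nonneg).1 hsum i (Finset.mem_univ i)
  rw [trace_conjTranspose_mul_self_eq_zero_iff] at hzero
  rw [neg_mul]
  exact eq_neg_of_add_eq_zero_left hzero

open scoped MatrixOrder Matrix.Norms.L2Operator in
theorem Matrix.PosSemidef.exists_eq_conjTranspose_mul_self {m : Type*} [Fintype m]
    [DecidableEq m] {M : Matrix m m ℂ} (hM : M.PosSemidef) : ∃ B : Matrix m m ℂ, M = Bᴴ * B :=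
  CStarAlgebra.nonneg_iff_eq_star_mul_self.mp hM.nonneg

section Frobenius

open scoped Matrix.Norms.Frobenius

theorem frobenius_norm_sq_eq_trace {m : Type*} [Fintype m] (B : Matrix m m ℂ) :
    ‖B‖ ^ 2 = (trace (Bᴴ * B)).re := by
  rw [frobenius_norm_def, ← Real.sqrt_eq_rpow, Real.sq_sqrt (by positivity), Finset.sum_comm]
  simp only [trace, diag_apply, mul_apply, Complex.re_sum, conjTranspose_apply]
  refine Finset.sum_congr rfl fun i _ => Finset.sum_congr rfl fun j _ => ?_
  rw [Complex.star_def, ← Complex.normSq_eq_conj_mul_self, Complex.ofReal_re,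
    Complex.normSq_eq_norm_sq]
  norm_num

theorem Matrix.PosSemidef.frobenius_norm_le_trace {m : Type*} [Fintype m] [DecidableEq m]
    {M : Matrix m m ℂ} (hM : M.PosSemidef) : ‖M‖ ≤ (trace M).re := by
  obtain ⟨B, rfl⟩ := hM.exists_eq_conjTranspose_mul_self
  calc ‖Bᴴ * B‖ ≤ ‖Bᴴ‖ * ‖B‖ := frobenius_norm_mul _ _
    _ = (trace (Bᴴ * B)).re := by
      rw [frobenius_norm_conjTranspose, ← frobenius_norm_sq_eq_trace, sq]

theorem isClosed_setOf_posSemidef {m : Type*} [Fintype m] :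
    IsClosed {M : Matrix m m ℂ | M.PosSemidef} := by
  simp only [posSemidef_iff_dotProduct_mulVec, IsHermitian, Set.ofPred_and, Set.ofPred_forall]
  refine (isClosed_eq (by fun_prop) (by fun_prop)).inter (isClosed_iInter fun x => ?_)
  exact isClosed_le (by fun_prop) (by fun_prop)

/-- The positive definite solutions of `(∑ i, A i * W * A i) * W = 1` contain one of least
trace. -/
theorem exists_trace_minimizer {ι m : Type*} [Fintype ι] [Fintype m] [DecidableEq m]
    (A : ι → Matrix m m ℂ)
    (hne : ∃ W : Matrix m m ℂ, W.PosDef ∧ (∑ i, A i * W * A i) * W = 1) :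
    ∃ C : Matrix m m ℂ, (C.PosDef ∧ (∑ i, A i * C * A i) * C = 1) ∧
      ∀ W : Matrix m m ℂ, W.PosDef → (∑ i, A i * W * A i) * W = 1 →
        (trace C).re ≤ (trace W).re := by
  obtain ⟨V, hV, hV1⟩ := hne
  set K : Set (Matrix m m ℂ) :=
    {W | W.PosSemidef ∧ (∑ i, A i * W * A i) * W = 1 ∧ (trace W).re ≤ (trace V).re}
  have hclosed : IsClosed K :=
    isClosed_setOf_posSemidef.inter
      ((isClosed_eq (f := fun W : Matrix m m ℂ => (∑ i, A i * W * A i) * W) (by fun_prop)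
        continuous_const).inter
      (isClosed_le (f := fun W : Matrix m m ℂ => (trace W).re) (by fun_prop) continuous_const))
  have hbounded : Bornology.IsBounded K :=
    isBounded_iff_forall_norm_le.2
      ⟨(trace V).re, fun W hW => hW.1.frobenius_norm_le_trace.trans hW.2.2⟩
  have : ProperSpace (Matrix m m ℂ) := FiniteDimensional.proper ℂ _
  obtain ⟨C, hCK, hmin⟩ := (Metric.isCompact_of_isClosed_isBounded hclosed hbounded).exists_isMinOn
    ⟨V, hV.posSemidef, hV1, le_rfl⟩ (f := fun W => (trace W).re) (by fun_prop)
  refine ⟨C, ⟨hCK.1.posDef_iff_isUnit.2 (IsUnit.of_mul_eq_one_right _ hCK.2.1), hCK.2.1⟩,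
    fun W hW hW1 => ?_⟩
  rcases le_total (trace W).re (trace V).re with h | h
  · exact hmin ⟨hW.posSemidef, hW1, h⟩
  · exact hCK.2.2.trans h

theorem trace_mul_eq_zero_of_trace_exp_ge {m : Type*} [Fintype m] [DecidableEq m]
    {C Y : Matrix m m ℂ} (hC : C.IsHermitian) (hY : Y.IsHermitian)
    (hmin : ∀ t : ℝ, (trace C).re ≤ (trace (NormedSpace.exp (t • Y) * C)).re) :
    trace (Y * C) = 0 := by
  have hderiv : HasDerivAt (fun t : ℝ => (trace (NormedSpace.exp (t • Y) * C)).re)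
      (trace (Y * C)).re 0 := by
    let L : Matrix m m ℂ →L[ℝ] ℝ := LinearMap.toContinuousLinearMap
      (Complex.reLm ∘ₗ (traceLinearMap m ℝ ℂ) ∘ₗ LinearMap.mulRight ℝ C)
    have h := L.hasFDerivAt.comp_hasDerivAt (0 : ℝ) (hasDerivAt_exp_smul_const Y (0 : ℝ))
    have hL : ∀ X, L X = (trace (X * C)).re := fun _ => rfl
    refine h.congr_deriv ?_
    rw [zero_smul, NormedSpace.exp_zero, one_mul]
    exact hL Y
  have hre := IsLocalMin.hasDerivAt_eq_zero
    (Filter.Eventually.of_forall fun t => by simpa using hmin t) hderiv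
  refine Complex.ext hre ?_
  have hstar : star (trace (Y * C)) = trace (Y * C) := by
    rw [← trace_conjTranspose, conjTranspose_mul, hC.eq, hY.eq, trace_mul_comm]
  exact Complex.conj_eq_iff_im.1 hstar

theorem exp_anticomm {m : Type*} [Fintype m] [DecidableEq m] {B Y : Matrix m m ℂ}
    (h : B * Y = -Y * B) : B * NormedSpace.exp Y = NormedSpace.exp (-Y) * B :=
  SemiconjBy.exp_right h

end Frobenius

theorem posDef_exp {m : Type*} [Fintype m] [DecidableEq m] {Y : Matrix m m ℂ}
    (hY : Y.IsHermitian) : (NormedSpace.exp Y).PosDef := by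
  have hhalf : ((1 / 2 : ℝ) • Y).IsHermitian := hY.smul (IsSelfAdjoint.all _)
  have h := (posSemidef_conjTranspose_mul_self (NormedSpace.exp ((1 / 2 : ℝ) • Y)))
  rw [hhalf.exp.eq, ← Matrix.exp_add_of_commute _ _ (Commute.refl _), ← add_smul, add_halves,
    one_smul] at h
  exact h.posDef_iff_isUnit.2 (Matrix.isUnit_exp Y)

/-- **trace minimizer in 𝕊.** Let `η(X) = ∑ᵢ Aᵢ X Aᵢ` with Hermitian Kraus
operators and suppose `𝕊 = {W ≻ 0 : η(W) W = I}` is nonempty.  Then (a) `𝕊` contains a trace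
minimizer `C`, and (b) for any trace minimizer `C`, with
`Φ(X) = C^{1/2} η(C^{1/2} X C^{1/2}) C^{1/2}`, every Hermitian `Y` with `Φ(Y) = -Y` satisfies
`Tr(Y C) = 0`. -/
theorem trace_minimizer_first_order_conditions {n r : ℕ}
    (A : Fin r → Matrix (Fin n) (Fin n) ℂ) (hA : ∀ i, (A i).IsHermitian)
    (hne : ∃ W : Matrix (Fin n) (Fin n) ℂ, W.PosDef ∧ (∑ i, A i * W * A i) * W = 1) :
    (∃ C : Matrix (Fin n) (Fin n) ℂ,
      (C.PosDef ∧ (∑ i, A i * C * A i) * C = 1) ∧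
      ∀ W : Matrix (Fin n) (Fin n) ℂ, W.PosDef → (∑ i, A i * W * A i) * W = 1 →
        (Matrix.trace C).re ≤ (Matrix.trace W).re) ∧
    (∀ C : Matrix (Fin n) (Fin n) ℂ, C.PosDef → (∑ i, A i * C * A i) * C = 1 →
      (∀ W : Matrix (Fin n) (Fin n) ℂ, W.PosDef → (∑ i, A i * W * A i) * W = 1 →
        (Matrix.trace C).re ≤ (Matrix.trace W).re) →
      ∀ Y : Matrix (Fin n) (Fin n) ℂ, Y.IsHermitian →
        matrixRPow C (1/2) *
            (∑ i, A i * (matrixRPow C (1/2) * Y * matrixRPow C (1/2)) * A i) *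
            matrixRPow C (1/2) = -Y →
        Matrix.trace (Y * C) = 0) := by
  refine ⟨exists_trace_minimizer A hne, fun C hC hC1 hmin Y hY hΦ => ?_⟩
  obtain ⟨hS, hSS⟩ := matrixRPow_half_spec hC
  set S := matrixRPow C (1 / 2)
  set B : Fin r → Matrix (Fin n) (Fin n) ℂ := fun i => S * A i * S with hBdef
  have hBH : ∀ i, (B i).IsHermitian := fun i => by
    simp only [hBdef, IsHermitian, conjTranspose_mul, hS.eq, (hA i).eq, mul_assoc]
  have hΦB : ∀ X, S * (∑ i, A i * (S * X * S) * A i) * S = ∑ i, B i * X * B i := fun X => by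
    simp only [hBdef, Finset.mul_sum, Finset.sum_mul, mul_assoc]
  have hB1 : ∑ i, B i * B i = 1 := by
    have h := hΦB 1
    simp only [mul_one, hSS] at h
    rw [← h, mul_assoc, mul_eq_one_comm, mul_assoc, hSS, hC1]
  have hSunit : IsUnit S := isUnit_of_mul_isUnit_left (hSS ▸ hC.isUnit)
  refine trace_mul_eq_zero_of_trace_exp_ge hC.isHermitian hY fun t => ?_
  set E := NormedSpace.exp (t • Y)
  have hΦE : ∑ i, B i * E * B i = NormedSpace.exp (-(t • Y)) := by
    have hanti : ∀ i, B i * E = NormedSpace.exp (-(t • Y)) * B i := fun i => exp_anticomm <| by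
      rw [mul_smul_comm, kraus_mul_eq_neg_mul hBH hB1 hY ((hΦB Y).symm.trans hΦ) i,
        ← smul_neg, smul_mul_assoc]
    simp only [hanti, mul_assoc]
    rw [← Finset.mul_sum, hB1, mul_one]
  have hE : E.PosDef := posDef_exp (hY.smul (IsSelfAdjoint.all t))
  have hW1 : (∑ i, A i * (S * E * S) * A i) * (S * E * S) = 1 := by
    have h : S * ((∑ i, A i * (S * E * S) * A i) * S * E) = 1 := by
      rw [← mul_assoc, ← mul_assoc, hΦB, hΦE, Matrix.exp_neg]
      exact nonsing_inv_mul _ ((isUnit_iff_isUnit_det _).1 hE.isUnit)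
    rw [← mul_eq_one_comm.1 h]
    simp only [mul_assoc]
  have hW : (S * E * S).PosDef := by
    have h := hE.conjTranspose_mul_mul_same (mulVec_injective_of_isUnit hSunit)
    rwa [hS.eq] at h
  calc (trace C).re ≤ (trace (S * E * S)).re := hmin _ hW hW1
    _ = (trace (E * C)).re := by rw [mul_assoc, trace_mul_comm, mul_assoc, hSS]
end

section
/- Let P_1,…,P_m ∈ M_n(ℂ) be pairwise orthogonal Hermitian projections with ∑_j P_j = I, and let η : M_n(ℂ) → M_n(ℂ) be a completely positive map (i.e., η admits some Kraus representation η(X) = ∑_l B_l X B_lᴴ). Then η satisfies η(P_j X P_k) = P_j η(X) P_k for all j, k and all X ∈ M_n(ℂ) if and only if η admits a Kraus representation η(X) = ∑_l A_l X A_lᴴ in which every Kraus operator A_l commutes with every projection P_j (equivalently, A_l = ∑_j P_j A_l P_j for all l). -/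
open Matrix
open scoped ComplexOrder

/-- If a sum of matrices `C * Cᴴ` vanishes, then so does every summand's factor. -/
lemma Matrix.eq_zero_of_sum_mul_conjTranspose_self_eq_zero {ι m n : Type*} [Fintype ι]
    [Fintype m] [Fintype n] (C : ι → Matrix m n ℂ) (h : ∑ l, C l * (C l)ᴴ = 0) (l : ι) :
    C l = 0 := by
  have htr : ∑ l, (C l * (C l)ᴴ).trace = 0 := by
    rw [← Matrix.trace_sum, h, Matrix.trace_zero]
  have hnonneg : ∀ l ∈ Finset.univ, 0 ≤ (C l * (C l)ᴴ).trace := fun l _ =>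
    (Matrix.posSemidef_self_mul_conjTranspose (C l)).trace_nonneg
  exact Matrix.trace_mul_conjTranspose_self_eq_zero_iff.mp
    ((Finset.sum_eq_zero_iff_of_nonneg hnonneg).mp htr l (Finset.mem_univ l))

/-- A matrix that is block diagonal with respect to a resolution of the identity commutes with
its members. -/
lemma Matrix.commute_of_offDiagonal_eq_zero {ι n R : Type*} [Fintype ι] [Fintype n]
    [DecidableEq n] [Semiring R] (P : ι → Matrix n n R) (hsum : ∑ j, P j = 1)
    (A : Matrix n n R) (h : ∀ i j, i ≠ j → P i * A * P j = 0) (j : ι) :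
    A * P j = P j * A := by
  have hleft : A * P j = P j * A * P j := by
    calc A * P j = ∑ i, P i * A * P j := by
          rw [← Finset.sum_mul, ← Finset.sum_mul, hsum, one_mul]
      _ = P j * A * P j := Fintype.sum_eq_single j fun i hi => h i j hi
  have hright : P j * A = P j * A * P j := by
    calc P j * A = ∑ i, P j * A * P i := by
          rw [← Finset.mul_sum, hsum, mul_one]
      _ = P j * A * P j := Fintype.sum_eq_single j fun i hi => h j i hi.symm
  exact hleft.trans hright.symm

/-- **Kraus characterization of bimodular maps.** Let `P₁, …, P_m` be pairwise
orthogonal Hermitian projections summing to `I`, and let `η(X) = ∑ₗ Bₗ X Bₗᴴ` be a completely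
positive map.  Then `η(P_j X P_k) = P_j η(X) P_k` for all `j, k, X` iff `η` admits a Kraus
representation whose Kraus operators all commute with every `P_j`. -/
theorem bimodular_iff_commuting_kraus {n s m : ℕ}
    (B : Fin s → Matrix (Fin n) (Fin n) ℂ)
    (P : Fin m → Matrix (Fin n) (Fin n) ℂ)
    (hherm : ∀ j, (P j).IsHermitian)
    (hproj : ∀ j, P j * P j = P j)
    (horth : ∀ j k, j ≠ k → P j * P k = 0)
    (hsum : ∑ j, P j = 1) :
    (∀ (j k : Fin m) (X : Matrix (Fin n) (Fin n) ℂ),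
        ∑ l, B l * (P j * X * P k) * (B l)ᴴ = P j * (∑ l, B l * X * (B l)ᴴ) * P k)
    ↔ ∃ (s' : ℕ) (A : Fin s' → Matrix (Fin n) (Fin n) ℂ),
        (∀ X : Matrix (Fin n) (Fin n) ℂ,
          ∑ l, A l * X * (A l)ᴴ = ∑ l, B l * X * (B l)ᴴ) ∧
        ∀ l j, A l * P j = P j * A l := by
  constructor
  · intro h
    refine ⟨s, B, fun _ => rfl, fun l => ?_⟩
    refine Matrix.commute_of_offDiagonal_eq_zero P hsum (B l) fun i j hij => ?_
    refine Matrix.eq_zero_of_sum_mul_conjTranspose_self_eq_zero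
      (fun l => P i * B l * P j) ?_ l
    calc ∑ l, P i * B l * P j * (P i * B l * P j)ᴴ
        = P i * (∑ l, B l * (P j * 1 * P j) * (B l)ᴴ) * P i := by
          simp only [Finset.mul_sum, Finset.sum_mul, Matrix.conjTranspose_mul,
            (hherm _).eq, Matrix.mul_assoc, Matrix.one_mul]
      _ = 0 := by
          rw [h j j 1, ← Matrix.mul_assoc, ← Matrix.mul_assoc, horth i j hij]
          simp only [Matrix.zero_mul]
  · rintro ⟨s', A, hA, hcomm⟩ j k X
    rw [← hA, ← hA, Finset.mul_sum, Finset.sum_mul]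
    refine Finset.sum_congr rfl fun l _ => ?_
    have hstar : P k * (A l)ᴴ = (A l)ᴴ * P k := by
      simpa only [Matrix.conjTranspose_mul, (hherm k).eq] using
        congrArg Matrix.conjTranspose (hcomm l k)
    calc A l * (P j * X * P k) * (A l)ᴴ
        = A l * P j * X * (P k * (A l)ᴴ) := by simp only [Matrix.mul_assoc]
      _ = P j * (A l * X * (A l)ᴴ) * P k := by
          rw [hcomm, hstar]
          simp only [Matrix.mul_assoc]
end
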